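/- Let T be a finite tree (a finite connected acyclic simple graph) with vertex set V, and let d : V → ℤ satisfy Σ_{v∈V} d(v) = 0. Then there exists a function n : V → ℤ such that δn = d, i.e. for every vertex u one has Σ_{x adjacent to u} (n(x) − n(u)) = d(u). (This is the combinatorial content of the paper's Construction of the Abel section: any line bundle of total degree zero on a compact-type curve can be twisted by boundary divisors so as to have degree zero on every irreducible component; here d records the negatives of the component degrees and n the multiplicities of the connected subcurves used as twists.) -/

import Mathlib

open Classical in
theorem tree_twist_aux (k : ℕ) :
    ∀ {V : Type*} [Fintype V] (G : SimpleGraph V) (_ : G.IsTree) (d : V → ℤ)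
      (_ : ∑ v, d v = 0) (_ : Fintype.card V = k),
    ∃ n : V → ℤ, ∀ u : V, ∑ x, (if G.Adj u x then n x - n u else 0) = d u := by
  induction k with
  | zero =>
    intro V _ G hT d hd hk
    have := Fintype.card_eq_zero_iff.mp hk
    exact ⟨fun _ => 0, fun u => this.elim u⟩
  | succ k ih =>
    intro V _ G hT d hd hk
    rcases subsingleton_or_nontrivial V with hs | hs
    · refine ⟨fun _ => 0, fun u => ?_⟩
      have : ∑ v, d v = d u := Fintype.sum_subsingleton d u
      simp [← this, hd]
    · obtain ⟨v, hv⟩ := hT.exists_vert_degree_one_of_nontrivial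
      have hconn := hT.1.induce_compl_singleton_of_degree_eq_one hv
      have hac : (G.induce ({v}ᶜ : Set V)).IsAcyclic := hT.2.induce _
      obtain ⟨w, hw, hwu⟩ := (SimpleGraph.degree_eq_one_iff_existsUnique_adj).mp hv
      have hadj : ∀ x, G.Adj v x ↔ x = w := fun x => ⟨hwu x, fun h => h ▸ hw⟩
      have hwv : w ≠ v := hw.ne'
      have key : ∀ f : V → ℤ, ∑ x, f x = f v + ∑ x : ({v}ᶜ : Set V), f x := by
        intro f
        rw [Fintype.sum_eq_add_sum_compl v]
        congr 1
        exact Finset.sum_subtype _ (by simp) f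
      obtain ⟨n, hn⟩ := ih (G.induce ({v}ᶜ : Set V)) ⟨hconn, hac⟩
        (fun x => d x + if (x : V) = w then d v else 0)
        (by
          have h1 := key d
          have h2 := key (fun x => if x = w then d v else 0)
          rw [Finset.sum_add_distrib]
          simp [hwv.symm] at h2
          linarith)
        (by
          rw [Fintype.card_compl_set]; simp [hk])
      let m : V → ℤ := fun x => if h : x = v then n ⟨w, hwv⟩ - d v else n ⟨x, h⟩
      have hmv : m v = n ⟨w, hwv⟩ - d v := by simp [m]
      have hmx : ∀ x : ({v}ᶜ : Set V), m x = n x := by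
        rintro ⟨x, hx⟩
        have hx' : x ≠ v := hx
        simp [m, hx']
      have hmw : m w = n ⟨w, hwv⟩ := hmx ⟨w, hwv⟩
      refine ⟨m, fun u => ?_⟩
      by_cases hu : u = v
      · subst hu
        simp only [hadj]
        rw [Finset.sum_ite_eq' Finset.univ w]
        simp [hmv, hmw]
      · have h := hn ⟨u, hu⟩
        rw [key]
        simp only [hmx]
        have hmu : m u = n ⟨u, hu⟩ := hmx ⟨u, hu⟩
        rw [hmu]
        simp only [SimpleGraph.comap_adj, Function.Embedding.subtype_apply] at h
        rw [h, G.adj_comm, hadj, hmv]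
        by_cases huw : u = w
        · subst huw; simp
        · simp [huw]

/-- On a finite tree, every integer vertex-weighting `d` of total sum
zero is the twist-degree `δn` of some `n : V → ℤ`, where
`(δn)(u) = ∑_{x ~ u} (n x - n u)`. -/
theorem tree_twist_degree_surjective_onto_sum_zero
    {V : Type*} [Fintype V] (G : SimpleGraph V) [DecidableRel G.Adj]
    (hT : G.IsTree) (d : V → ℤ) (hd : ∑ v, d v = 0) :
    ∃ n : V → ℤ, ∀ u : V, ∑ x ∈ G.neighborFinset u, (n x - n u) = d u := by
  obtain ⟨n, hn⟩ := tree_twist_aux _ G hT d hd rfl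
  refine ⟨n, fun u => ?_⟩
  rw [← hn u, SimpleGraph.neighborFinset_eq_filter, Finset.sum_filter]
  refine Finset.sum_congr rfl fun x _ => ?_
  congr
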